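/- Let T : ℝ^d × 𝒳 → 𝒳 be a continuous action of ℝ^d on a compact metric space (𝒳, 𝐝). Let λ be a Borel probability measure on M^T(𝒳) and let μ = ∫_{M^T(𝒳)} ν dλ(ν) be its barycenter. For every ε > 0, R(𝐝, μ, ε) ≥ inf { ∫_{M^T(𝒳)} R(𝐝, ν, ε_ν) dλ(ν) }, where the infimum is taken over all measurable functions M^T(𝒳) ∋ ν ↦ ε_ν ∈ (0,∞) satisfying ∫_{M^T(𝒳)} ε_ν dλ(ν) ≤ ε. -/

import Mathlib

open MeasureTheory Filter Set
open scoped ENNReal Topology NNReal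

noncomputable section

/-- Shannon entropy (base 2) of a finitely-valued random variable. -/
def shannonEntropy {Ω S : Type*} [MeasurableSpace Ω] [Fintype S]
    (P : Measure Ω) (f : Ω → S) : ℝ :=
  -∑ i : S, ((P (f ⁻¹' {i})).toReal * Real.logb 2 ((P (f ⁻¹' {i})).toReal))

/-- Mutual information (base 2) of two random variables, defined as the supremum over all
finite measurable partitions (encoded as measurable maps into `Fin n`) of
`H(α∘X) + H(β∘Y) - H(α∘X, β∘Y)`. -/
def mutualInfo {Ω A B : Type*} [MeasurableSpace Ω] [MeasurableSpace A] [MeasurableSpace B]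
    (P : Measure Ω) (X : Ω → A) (Y : Ω → B) : ℝ≥0∞ :=
  ⨆ (n : ℕ) (m : ℕ) (α : A → Fin n) (_ : Measurable α) (β : B → Fin m) (_ : Measurable β),
    ENNReal.ofReal (shannonEntropy P (fun ω => α (X ω)) + shannonEntropy P (fun ω => β (Y ω))
      - shannonEntropy P (fun ω => (α (X ω), β (Y ω))))

/-- The box `[0,L)^d ⊆ ℝ^d`. -/
def unitBox (d : ℕ) (L : ℝ) : Set (Fin d → ℝ) := Set.univ.pi fun _ => Set.Ico (0 : ℝ) L

/-- Lebesgue measure on `ℝ^d` restricted to the box `[0,L)^d`. -/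
def boxMeasure (d : ℕ) (L : ℝ) : Measure (Fin d → ℝ) := volume.restrict (unitBox d L)

/-- The space `L¹([0,L)^d, X)` of measurable maps modulo a.e. equality. -/
abbrev L1Maps (d : ℕ) (L : ℝ) (X : Type*) [TopologicalSpace X] :=
  (Fin d → ℝ) →ₘ[boxMeasure d L] X

/-- The `L¹` distance `D(f,g) = ∫_{[0,L)^d} 𝐝(f(u), g(u)) dm(u)`. -/
def L1dist {d : ℕ} {L : ℝ} {X : Type*} [MetricSpace X] (f g : L1Maps d L X) : ℝ :=
  ∫ u, dist (f u) (g u) ∂(boxMeasure d L)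

/-- The Borel σ-algebra of the metric `L1dist` on `L¹([0,L)^d, X)`,
generated by the open balls of the metric. -/
instance L1Maps.measurableSpace {d : ℕ} {L : ℝ} {X : Type*} [MetricSpace X] :
    MeasurableSpace (L1Maps d L X) :=
  MeasurableSpace.generateFrom {s | ∃ (f : L1Maps d L X) (r : ℝ), s = {g | L1dist f g < r}}

/-- The expected mean distortion `E[(1/L^d) ∫_{[0,L)^d} 𝐝(T^u X, Y_u) dm(u)]`. -/
def distortion {X : Type*} [MetricSpace X] (d : ℕ) (T : (Fin d → ℝ) → X → X) (L : ℝ)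
    {Ω : Type*} [MeasurableSpace Ω] (P : Measure Ω) (Xv : Ω → X) (Yv : Ω → L1Maps d L X) : ℝ :=
  ∫ ω, (L ^ d)⁻¹ * ∫ u, dist (T u (Xv ω)) (Yv ω u) ∂(boxMeasure d L) ∂P

/-- `R_L(𝐝, μ, ε)`: the infimum of `I(X;Y)` over all pairs of random variables on a common
probability space with `Law X = μ`, `Y` taking values in `L¹([0,L)^d, X)` and expected mean
distortion `< ε`. -/
def RL {X : Type*} [MetricSpace X] [MeasurableSpace X] (d : ℕ)
    (T : (Fin d → ℝ) → X → X) (μ : Measure X) (L ε : ℝ) : ℝ≥0∞ :=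
  ⨅ (Ω : Type) (_ : MeasurableSpace Ω) (P : Measure Ω) (_ : IsProbabilityMeasure P)
    (Xv : Ω → X) (Yv : Ω → L1Maps d L X) (_ : Measurable Xv) (_ : Measurable Yv)
    (_ : Measure.map Xv P = μ) (_ : distortion d T L P Xv Yv < ε),
    mutualInfo P Xv Yv

/-- The rate distortion function `R(𝐝, μ, ε) = lim_{L→∞} R_L(𝐝, μ, ε)/L^d`, which exists and
equals `inf_{L>0} R_L(𝐝, μ, ε)/L^d`. -/
def RD {X : Type*} [MetricSpace X] [MeasurableSpace X] (d : ℕ)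
    (T : (Fin d → ℝ) → X → X) (μ : Measure X) (ε : ℝ) : ℝ≥0∞ :=
  ⨅ (L : ℝ) (_ : 0 < L), RL d T μ L ε / ENNReal.ofReal (L ^ d)

/-- Upper rate distortion dimension. -/
def urdim {X : Type*} [MetricSpace X] [MeasurableSpace X] (d : ℕ)
    (T : (Fin d → ℝ) → X → X) (μ : Measure X) : ℝ≥0∞ :=
  Filter.limsup (fun ε : ℝ => RD d T μ ε / ENNReal.ofReal (Real.logb 2 (1 / ε))) (𝓝[>] (0 : ℝ))

/-- Lower rate distortion dimension. -/
def lrdim {X : Type*} [MetricSpace X] [MeasurableSpace X] (d : ℕ)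
    (T : (Fin d → ℝ) → X → X) (μ : Measure X) : ℝ≥0∞ :=
  Filter.liminf (fun ε : ℝ => RD d T μ ε / ENNReal.ofReal (Real.logb 2 (1 / ε))) (𝓝[>] (0 : ℝ))

/-- `μ` is invariant under the `ℝ^d`-action `T`. -/
def MeasInvariant {X : Type*} [MeasurableSpace X] (d : ℕ)
    (T : (Fin d → ℝ) → X → X) (μ : Measure X) : Prop :=
  ∀ u : Fin d → ℝ, Measure.map (T u) μ = μ

/-- `T` is a continuous action of the additive group `ℝ^d`. -/
def IsContAction {X : Type*} [TopologicalSpace X] (d : ℕ) (T : (Fin d → ℝ) → X → X) : Prop :=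
  Continuous (fun p : (Fin d → ℝ) × X => T p.1 p.2) ∧ (∀ x, T 0 x = x) ∧
    ∀ u v x, T (u + v) x = T u (T v x)

/-- The metric `𝐝_L(x,y) = sup_{u ∈ [0,L)^d} 𝐝(T^u x, T^u y)`. -/
def dSup {X : Type*} [MetricSpace X] (d : ℕ) (T : (Fin d → ℝ) → X → X) (L : ℝ) (x y : X) : ℝ :=
  ⨆ u : unitBox d L, dist (T u.1 x) (T u.1 y)

/-- The `ε`-covering number of `X` for the (pre)metric `ρ`: the minimal number of open sets
of `ρ`-diameter `< ε` covering `X`. -/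
def covNum (X : Type*) [TopologicalSpace X] (ρ : X → X → ℝ) (ε : ℝ) : ℕ :=
  sInf {n : ℕ | ∃ F : Finset (Set X), F.card = n ∧
    (∀ U ∈ F, IsOpen U ∧ (⨆ x ∈ U, ⨆ y ∈ U, ENNReal.ofReal (ρ x y)) < ENNReal.ofReal ε) ∧
    ⋃₀ (F : Set (Set X)) = Set.univ}

/-- The entropy at scale `ε`: `S(X,T,𝐝,ε) = lim_{L→∞} log₂ #(X, 𝐝_L, ε) / L^d`
(the limit exists, hence equals the limsup used here). -/
def entScale {X : Type*} [MetricSpace X] (d : ℕ) (T : (Fin d → ℝ) → X → X) (ε : ℝ) : ℝ≥0∞ :=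
  Filter.limsup
    (fun L : ℝ => ENNReal.ofReal (Real.logb 2 (covNum X (dSup d T L) ε) / L ^ d)) Filter.atTop

/-- The upper metric mean dimension. -/
def umdim {X : Type*} [MetricSpace X] (d : ℕ) (T : (Fin d → ℝ) → X → X) : ℝ≥0∞ :=
  Filter.limsup (fun ε : ℝ => entScale d T ε / ENNReal.ofReal (Real.logb 2 (1 / ε))) (𝓝[>] (0 : ℝ))

/-- The σ-algebra on the space of Borel probability measures on `X` (for a compact metric `X`
this is the Borel σ-algebra of the weak* topology). -/
instance ProbabilityMeasure.measurableSpace' {α : Type*} [MeasurableSpace α] :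
    MeasurableSpace (ProbabilityMeasure α) :=
  inferInstanceAs (MeasurableSpace {μ : Measure α // IsProbabilityMeasure μ})

/-- The space `M^T(X)` of `T`-invariant Borel probability measures on `X`. -/
abbrev InvM (X : Type*) [MeasurableSpace X] [MetricSpace X] (d : ℕ)
    (T : (Fin d → ℝ) → X → X) :=
  {ν : ProbabilityMeasure X // MeasInvariant d T (ν : Measure X)}

end


section InfoHelpers
open Real

lemma shannonEntropy_eq {Ω S : Type*} [MeasurableSpace Ω] [Fintype S]
    (P : Measure Ω) (f : Ω → S) :
    shannonEntropy P f = (∑ i : S, negMulLog (P.real (f ⁻¹' {i}))) / Real.log 2 := by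
  unfold shannonEntropy
  rw [Finset.sum_div, ← Finset.sum_neg_distrib]
  refine Finset.sum_congr rfl fun i _ => ?_
  simp only [negMulLog, Real.logb, Measure.real]
  ring

/-- The mutual information (in nats) of a finite channel. -/
noncomputable def chanInfo {A : Type*} [MeasurableSpace A] {m : ℕ} (ν : Measure A)
    (p : Fin m → A → ℝ) : ℝ :=
  ∑ j, (negMulLog (∫ x, p j x ∂ν) - ∫ x, negMulLog (p j x) ∂ν)

/-- A finite channel. -/
structure IsChan {A : Type*} [MeasurableSpace A] {m : ℕ} (p : Fin m → A → ℝ) : Prop where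
  meas : ∀ j, Measurable (p j)
  nonneg : ∀ j x, 0 ≤ p j x
  sum_one : ∀ x, ∑ j, p j x = 1

namespace IsChan
variable {A : Type*} [MeasurableSpace A] {m : ℕ} {p : Fin m → A → ℝ}

lemma le_one (h : IsChan p) (j x) : p j x ≤ 1 := by
  rw [← h.sum_one x]
  exact Finset.single_le_sum (f := fun j => p j x) (fun i _ => h.nonneg i x) (Finset.mem_univ j)

lemma integrable (h : IsChan p) (ν : Measure A) [IsFiniteMeasure ν] (j) : Integrable (p j) ν :=
  Integrable.of_bound (h.meas j).aestronglyMeasurable 1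
    (ae_of_all _ fun x => by
      rw [Real.norm_of_nonneg (h.nonneg j x)]; exact h.le_one j x)

lemma nml_nonneg (h : IsChan p) (j x) : 0 ≤ negMulLog (p j x) :=
  negMulLog_nonneg (h.nonneg j x) (h.le_one j x)

lemma nml_le (h : IsChan p) (j x) : negMulLog (p j x) ≤ 1 := by
  have h0 := h.nonneg j x
  have := Real.negMulLog_le_one_sub_self h0
  linarith

lemma integrable_nml (h : IsChan p) (ν : Measure A) [IsFiniteMeasure ν] (j) :
    Integrable (fun x => negMulLog (p j x)) ν :=
  Integrable.of_bound (continuous_negMulLog.measurable.comp (h.meas j)).aestronglyMeasurable 1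
    (ae_of_all _ fun x => by
      rw [Real.norm_of_nonneg (h.nml_nonneg j x)]; exact h.nml_le j x)

end IsChan

lemma tangent_ineq {p P s : ℝ} (hp : 0 ≤ p) (hP : 0 ≤ P) (hs : 0 < s) (h : P = 0 → p = 0) :
    p * Real.log s + p - s * P ≤ - negMulLog p - p * Real.log P := by
  rcases hp.eq_or_lt with rfl | hp'
  · simp only [zero_mul, negMulLog_zero]; nlinarith
  · have hP' : 0 < P := lt_of_le_of_ne hP fun h' => hp'.ne' (h h'.symm)
    have := Real.log_le_sub_one_of_pos (x := s * P / p) (by positivity)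
    rw [Real.log_div (by positivity) (by positivity), Real.log_mul hs.ne' hP'.ne'] at this
    have h2 := mul_le_mul_of_nonneg_left this hp
    have h3 : p * (s * P / p - 1) = s * P - p := by field_simp
    rw [h3] at h2
    simp only [negMulLog]
    nlinarith

section
variable {A : Type*} [MeasurableSpace A] {m : ℕ} {p : Fin m → A → ℝ}

lemma integral_chan_sum (h : IsChan p) (ν : Measure A) [IsFiniteMeasure ν] :
    ∑ j, ∫ x, p j x ∂ν = ν.real univ := by
  rw [← integral_finsetSum _ fun j _ => h.integrable ν j]
  simp [h.sum_one]

/-- The joint law of `(X, N)` is given by `ν` and the channel `p`. -/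
structure JointLaw {Ω : Type*} [MeasurableSpace Ω] (P : Measure Ω) (Xv : Ω → A) (N : Ω → Fin m)
    (ν : Measure A) (p : Fin m → A → ℝ) : Prop where
  joint : ∀ S : Set A, MeasurableSet S → ∀ j, P.real (Xv ⁻¹' S ∩ N ⁻¹' {j}) = ∫ x in S, p j x ∂ν
  mN : Measurable N
  mX : Measurable Xv

variable {Ω : Type*} [MeasurableSpace Ω] {P : Measure Ω} [IsProbabilityMeasure P]
  {Xv : Ω → A} {N : Ω → Fin m} {ν : Measure A} [IsProbabilityMeasure ν]

lemma JointLaw.joint' (hJ : JointLaw P Xv N ν p) {k : ℕ} (β : Fin m → Fin k)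
    {S : Set A} (hS : MeasurableSet S) (b : Fin k) :
    P.real (Xv ⁻¹' S ∩ (fun ω => β (N ω)) ⁻¹' {b})
      = ∑ j with β j = b, ∫ x in S, p j x ∂ν := by
  classical
  have : Xv ⁻¹' S ∩ (fun ω => β (N ω)) ⁻¹' {b}
      = ⋃ j ∈ (Finset.univ.filter fun j => β j = b), (Xv ⁻¹' S ∩ N ⁻¹' {j}) := by
    ext ω; simp
  rw [this, measureReal_biUnion_finset]
  · exact Finset.sum_congr rfl fun j _ => hJ.joint S hS j
  · intro i _ j _ hij
    refine Set.disjoint_left.2 fun ω h1 h2 => hij ?_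
    have e1 : N ω = i := h1.2
    have e2 : N ω = j := h2.2
    exact e1.symm.trans e2
  · intro j _
    exact (hJ.mX hS).inter (hJ.mN (measurableSet_singleton j))

lemma JointLaw.info_le (hJ : JointLaw P Xv N ν p) (hp : IsChan p) {n k : ℕ} (α : A → Fin n)
    (hα : Measurable α) (β : Fin m → Fin k) :
    shannonEntropy P (fun ω => α (Xv ω)) + shannonEntropy P (fun ω => β (N ω))
      - shannonEntropy P (fun ω => (α (Xv ω), β (N ω))) ≤ chanInfo ν p / Real.log 2 := by
  classical
  have hmS : ∀ a, MeasurableSet (α ⁻¹' {a}) := fun a => hα (measurableSet_singleton a)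
  have hl2 : 0 < Real.log 2 := Real.log_pos (by norm_num)
  set q : Fin n → Fin k → ℝ := fun a b =>
    P.real ((fun ω => α (Xv ω)) ⁻¹' {a} ∩ (fun ω => β (N ω)) ⁻¹' {b}) with hq
  have hqe : ∀ a b, q a b = ∑ j with β j = b, ∫ x in α ⁻¹' {a}, p j x ∂ν := fun a b =>
    hJ.joint' β (hmS a) b
  have hm1 : ∀ a, MeasurableSet ((fun ω => α (Xv ω)) ⁻¹' {a}) := fun a => hJ.mX (hmS a)
  have hm2 : ∀ b, MeasurableSet ((fun ω => β (N ω)) ⁻¹' {b}) := fun b =>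
    hJ.mN (Set.toFinite (β ⁻¹' {b})).measurableSet
  have hqa : ∀ a, P.real ((fun ω => α (Xv ω)) ⁻¹' {a}) = ∑ b, q a b := by
    intro a
    have : (fun ω => α (Xv ω)) ⁻¹' {a} = ⋃ b ∈ (Finset.univ : Finset (Fin k)),
      ((fun ω => α (Xv ω)) ⁻¹' {a} ∩ (fun ω => β (N ω)) ⁻¹' {b}) := by ext ω; simp
    conv_lhs => rw [this]
    rw [measureReal_biUnion_finset]
    · intro i _ j _ hij
      refine Set.disjoint_left.2 fun ω h1 h2 => hij ?_
      exact Eq.trans (Eq.symm h1.2) h2.2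
    · intro b _; exact (hm1 a).inter (hm2 b)
  have hqb : ∀ b, P.real ((fun ω => β (N ω)) ⁻¹' {b}) = ∑ a, q a b := by
    intro b
    have : (fun ω => β (N ω)) ⁻¹' {b} = ⋃ a ∈ (Finset.univ : Finset (Fin n)),
      ((fun ω => α (Xv ω)) ⁻¹' {a} ∩ (fun ω => β (N ω)) ⁻¹' {b}) := by ext ω; simp
    conv_lhs => rw [this]
    rw [measureReal_biUnion_finset]
    · intro i _ j _ hij
      refine Set.disjoint_left.2 fun ω h1 h2 => hij ?_
      exact Eq.trans (Eq.symm h1.1) h2.1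
    · intro a _; exact (hm1 a).inter (hm2 b)
  have hqa' : ∀ a, ∑ b, q a b = ν.real (α ⁻¹' {a}) := by
    intro a
    simp_rw [hqe]
    rw [Finset.sum_fiberwise, integral_chan_sum hp (ν.restrict (α ⁻¹' {a}))]
    simp [Measure.real]
  have hpart : ∀ g : A → ℝ, Integrable g ν → ∑ a, ∫ x in α ⁻¹' {a}, g x ∂ν = ∫ x, g x ∂ν := by
    intro g hg
    have : (univ : Set A) = ⋃ a, α ⁻¹' {a} := by ext; simp
    rw [← setIntegral_univ (μ := ν), this, integral_iUnion_fintype hmS]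
    · intro i j hij
      refine Set.disjoint_left.2 fun ω h1 h2 => hij ?_
      exact Eq.trans (Eq.symm h1) h2
    · intro a; exact hg.integrableOn
  set M : Fin m → ℝ := fun j => ∫ x, p j x ∂ν with hM
  have hM0 : ∀ j, 0 ≤ M j := fun j => integral_nonneg (hp.nonneg j)
  have hqb' : ∀ b, ∑ a, q a b = ∑ j with β j = b, M j := by
    intro b
    simp_rw [hqe]
    rw [Finset.sum_comm]
    exact Finset.sum_congr rfl fun j _ => hpart _ (hp.integrable ν j)
  have hMz : ∀ j, ∀ᵐ x ∂ν, M j = 0 → p j x = 0 := by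
    intro j
    by_cases h : M j = 0
    · have := (integral_eq_zero_iff_of_nonneg (hp.nonneg j) (hp.integrable ν j)).1 h
      filter_upwards [this] with x hx _ using hx
    · exact ae_of_all _ fun x h' => absurd h' h
  have hq0 : ∀ a b, 0 ≤ q a b := fun a b => measureReal_nonneg
  set G : Fin n → Fin m → ℝ := fun a j =>
    ∫ x in α ⁻¹' {a}, (- negMulLog (p j x) - p j x * Real.log (M j)) ∂ν with hG
  have hGi : ∀ j, Integrable (fun x => - negMulLog (p j x) - p j x * Real.log (M j)) ν :=
    fun j => (hp.integrable_nml ν j).neg.sub ((hp.integrable ν j).mul_const _)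
  have hcell0 : ∀ a b s, 0 < s → q a b * Real.log s + q a b - s * ((∑ b, q a b) * ∑ a, q a b)
      ≤ ∑ j with β j = b, G a j := by
    intro a b s hs
    have : ∀ j, (∫ x in α ⁻¹' {a}, p j x ∂ν) * Real.log s + (∫ x in α ⁻¹' {a}, p j x ∂ν)
        - s * (ν.real (α ⁻¹' {a}) * M j) ≤ G a j := by
      intro j
      have hi := (hp.integrable ν j).integrableOn (s := α ⁻¹' {a})
      have e : ∫ x in α ⁻¹' {a}, (p j x * Real.log s + p j x - s * M j) ∂ν =
          (∫ x in α ⁻¹' {a}, p j x ∂ν) * Real.log s + (∫ x in α ⁻¹' {a}, p j x ∂ν)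
            - s * (ν.real (α ⁻¹' {a}) * M j) := by
        rw [integral_sub (f := fun x => p j x * Real.log s + p j x) ((hi.mul_const _).add hi)
          (integrable_const _), integral_add (hi.mul_const _) hi, integral_mul_const]
        simp; ring
      rw [← e]
      refine integral_mono_ae (((hi.mul_const _).add hi).sub (integrable_const _))
        (hGi j).integrableOn ?_
      filter_upwards [ae_restrict_of_ae (hMz j)] with x hx
      exact tangent_ineq (hp.nonneg j x) (hM0 j) hs hx
    have h2 := Finset.sum_le_sum fun j (_ : j ∈ Finset.univ.filter fun j => β j = b) => this j
    refine le_trans (le_of_eq ?_) h2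
    rw [Finset.sum_sub_distrib, Finset.sum_add_distrib, ← Finset.sum_mul, ← hqe, ← Finset.mul_sum,
      ← Finset.mul_sum, hqa', hqb']
  have hcell : ∀ a b, - negMulLog (q a b) - q a b * Real.log (∑ b, q a b)
      - q a b * Real.log (∑ a, q a b) ≤ ∑ j with β j = b, G a j := by
    intro a b
    rcases (hq0 a b).eq_or_lt with h | h
    · rw [← h]
      simp only [negMulLog_zero, zero_mul, sub_zero, neg_zero]
      set c := (∑ b, q a b) * ∑ a, q a b with hc
      have hc0 : 0 ≤ c := mul_nonneg (Finset.sum_nonneg fun _ _ => hq0 _ _)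
        (Finset.sum_nonneg fun _ _ => hq0 _ _)
      refine le_of_forall_pos_le_add fun e he => ?_
      have := hcell0 a b (e / (c + 1)) (by positivity)
      rw [← h, ← hc] at this
      have h3 : e / (c + 1) * c ≤ e := by
        rw [div_mul_eq_mul_div, div_le_iff₀ (by positivity)]; nlinarith
      linarith
    · have h1 : 0 < ∑ b, q a b := lt_of_lt_of_le h
        (Finset.single_le_sum (f := fun b => q a b) (fun _ _ => hq0 _ _) (Finset.mem_univ b))
      have h2 : 0 < ∑ a, q a b := lt_of_lt_of_le h
        (Finset.single_le_sum (f := fun a => q a b) (fun _ _ => hq0 _ _) (Finset.mem_univ a))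
      refine le_trans (le_of_eq ?_) (hcell0 a b (q a b / ((∑ b, q a b) * ∑ a, q a b))
        (by positivity))
      rw [Real.log_div h.ne' (by positivity), Real.log_mul h1.ne' h2.ne',
        div_mul_cancel₀ _ (by positivity)]
      simp only [negMulLog]; ring
  rw [shannonEntropy_eq, shannonEntropy_eq, shannonEntropy_eq, ← add_div, ← sub_div]
  refine div_le_div_of_nonneg_right ?_ hl2.le
  have hpair : ∀ a b, P.real ((fun ω => (α (Xv ω), β (N ω))) ⁻¹' {(a, b)}) = q a b := by
    intro a b
    simp only [hq]
    congr 1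
    ext ω; simp
  rw [Fintype.sum_prod_type]
  simp_rw [hpair, hqa, hqb]
  have hfin : ∑ a, ∑ b, (∑ j with β j = b, G a j) = chanInfo ν p := by
    have : ∀ a, ∑ b, (∑ j with β j = b, G a j) = ∑ j, G a j := fun a =>
      Finset.sum_fiberwise _ _ _
    simp_rw [this]
    rw [Finset.sum_comm]
    refine Finset.sum_congr rfl fun j _ => ?_
    rw [hpart _ (hGi j), integral_sub (f := fun x => - negMulLog (p j x)) (hp.integrable_nml ν j).neg
      ((hp.integrable ν j).mul_const _), integral_mul_const]
    rw [integral_neg]; simp only [hM, negMulLog]; ring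
  rw [← hfin]
  refine le_trans (le_of_eq ?_) (Finset.sum_le_sum fun a _ => Finset.sum_le_sum fun b _ => hcell a b)
  simp_rw [Finset.sum_sub_distrib, Finset.sum_neg_distrib]
  have e1 : ∀ a, ∑ b, q a b * Real.log (∑ b, q a b) = - negMulLog (∑ b, q a b) := by
    intro a; rw [← Finset.sum_mul]; simp [negMulLog]
  have e2 : ∑ a, ∑ b, q a b * Real.log (∑ a, q a b) = - ∑ b, negMulLog (∑ a, q a b) := by
    rw [Finset.sum_comm, ← Finset.sum_neg_distrib]
    refine Finset.sum_congr rfl fun b _ => ?_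
    rw [← Finset.sum_mul]; simp [negMulLog]
  rw [e2]
  simp_rw [e1]
  rw [Finset.sum_neg_distrib]
  ring

lemma exists_fine_partition (hp : IsChan p) {δ : ℝ} (hδ : 0 < δ) :
    ∃ (n : ℕ) (α : A → Fin n), Measurable α ∧ ∀ x y, α x = α y → ∀ j, |p j x - p j y| < δ := by
  obtain ⟨k, hk⟩ := exists_nat_gt (1 / δ)
  have hk0 : (0 : ℝ) < k := lt_trans (by positivity) hk
  have hlt : ∀ j x, ⌊(k : ℝ) * p j x⌋₊ < k + 1 := by
    intro j x
    rw [Nat.lt_succ_iff]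
    refine Nat.floor_le_of_le ?_
    nlinarith [hp.le_one j x]
  let α0 : A → (Fin m → Fin (k + 1)) := fun x j => ⟨⌊(k : ℝ) * p j x⌋₊, hlt j x⟩
  have hα0 : Measurable α0 := by
    refine measurable_pi_lambda _ fun j => ?_
    refine measurable_to_countable' fun i => ?_
    have : (fun x => α0 x j) ⁻¹' {i} = (fun x => ⌊(k : ℝ) * p j x⌋₊) ⁻¹' {(i : ℕ)} := by
      ext x; simp [α0, Fin.ext_iff]
    rw [this]
    exact (Nat.measurable_floor.comp ((hp.meas j).const_mul _)) (measurableSet_singleton _)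
  refine ⟨_, fun x => Fintype.equivFin _ (α0 x), (measurable_of_countable _).comp hα0, ?_⟩
  intro x y hxy j
  have h1 : α0 x = α0 y := (Fintype.equivFin _).injective hxy
  have h2 : ⌊(k : ℝ) * p j x⌋₊ = ⌊(k : ℝ) * p j y⌋₊ := by
    have := congrFun h1 j
    simpa [α0] using this
  have a1 := Nat.floor_le (mul_nonneg hk0.le (hp.nonneg j x))
  have a2 := Nat.lt_floor_add_one ((k : ℝ) * p j x)
  have b1 := Nat.floor_le (mul_nonneg hk0.le (hp.nonneg j y))
  have b2 := Nat.lt_floor_add_one ((k : ℝ) * p j y)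
  rw [h2] at a1 a2
  have : |k * (p j x - p j y)| < 1 := by rw [abs_lt]; constructor <;> linarith
  rw [abs_mul, abs_of_pos hk0] at this
  rw [div_lt_iff₀ hδ] at hk
  by_contra hcon
  push Not at hcon
  nlinarith

lemma JointLaw.le_info (hJ : JointLaw P Xv N ν p) (hp : IsChan p) {η : ℝ} (hη : 0 < η) :
    ∃ (n : ℕ) (α : A → Fin n), Measurable α ∧ (chanInfo ν p - m * η) / Real.log 2 ≤
      shannonEntropy P (fun ω => α (Xv ω)) + shannonEntropy P N
      - shannonEntropy P (fun ω => (α (Xv ω), N ω)) := by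
  classical
  have huc : UniformContinuousOn negMulLog (Icc 0 1) :=
    isCompact_Icc.uniformContinuousOn_of_continuous continuous_negMulLog.continuousOn
  obtain ⟨δ, hδ, hδ'⟩ := Metric.uniformContinuousOn_iff.1 huc η hη
  obtain ⟨n, α, hα, hosc⟩ := exists_fine_partition hp (half_pos hδ)
  refine ⟨n, α, hα, ?_⟩
  have hl2 : 0 < Real.log 2 := Real.log_pos (by norm_num)
  have hmS : ∀ a, MeasurableSet (α ⁻¹' {a}) := fun a => hα (measurableSet_singleton a)
  have hpart : ∀ g : A → ℝ, Integrable g ν → ∑ a, ∫ x in α ⁻¹' {a}, g x ∂ν = ∫ x, g x ∂ν := by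
    intro g hg
    have : (univ : Set A) = ⋃ a, α ⁻¹' {a} := by ext; simp
    rw [← setIntegral_univ (μ := ν), this, integral_iUnion_fintype hmS]
    · intro i j hij
      refine Set.disjoint_left.2 fun ω h1 h2 => hij ?_
      exact Eq.trans (Eq.symm h1) h2
    · intro a; exact hg.integrableOn
  set q : Fin n → Fin m → ℝ := fun a j => ∫ x in α ⁻¹' {a}, p j x ∂ν with hq
  have hpair : ∀ a b, P.real ((fun ω => (α (Xv ω), N ω)) ⁻¹' {(a, b)}) = q a b := by
    intro a b
    simp only [hq]
    rw [← hJ.joint _ (hmS a)]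
    congr 1
    ext ω; simp
  have hNb : ∀ j, P.real (N ⁻¹' {j}) = ∫ x, p j x ∂ν := by
    intro j
    have := hJ.joint univ MeasurableSet.univ j
    simpa using this
  have hXa : ∀ a, P.real ((fun ω => α (Xv ω)) ⁻¹' {a}) = ν.real (α ⁻¹' {a}) := by
    intro a
    have h1 := integral_chan_sum hp (ν.restrict (α ⁻¹' {a}))
    have h2 : ∑ j, q a j = P.real ((fun ω => α (Xv ω)) ⁻¹' {a}) := by
      simp only [hq]
      simp_rw [← hJ.joint _ (hmS a)]
      rw [← measureReal_biUnion_finset]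
      · congr 1; ext ω; simp
      · intro i _ j _ hij
        refine Set.disjoint_left.2 fun ω h1 h2 => hij ?_
        exact Eq.trans (Eq.symm h1.2) h2.2
      · intro b _; exact (hJ.mX (hmS a)).inter (hJ.mN (measurableSet_singleton _))
    rw [← h2, h1]; simp [Measure.real]
  have hqs : ∀ a, ∑ j, q a j = ν.real (α ⁻¹' {a}) := by
    intro a
    simp only [hq]
    rw [integral_chan_sum hp (ν.restrict (α ⁻¹' {a}))]; simp [Measure.real]
  -- cell bound
  have hcell : ∀ a, ∑ j, negMulLog (q a j) ≤ negMulLog (ν.real (α ⁻¹' {a}))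
      + ∑ j, ((∫ x in α ⁻¹' {a}, negMulLog (p j x) ∂ν) + η * ν.real (α ⁻¹' {a})) := by
    intro a
    set w := ν.real (α ⁻¹' {a}) with hw
    rcases (measureReal_nonneg (μ := ν) (s := α ⁻¹' {a})).eq_or_lt with h0 | h0
    · have hz : ν (α ⁻¹' {a}) = 0 := by
        rw [eq_comm, measureReal_eq_zero_iff] at h0; exact h0
      have hr : ν.restrict (α ⁻¹' {a}) = 0 := Measure.restrict_eq_zero.2 hz
      have hw0 : w = 0 := h0.symm
      simp [hq, hr, hw0]
    · have hw0 : 0 < w := h0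
      set r : Fin m → ℝ := fun j => q a j / w with hr
      have hqr : ∀ j, q a j = w * r j := fun j => by simp only [hr]; field_simp
      have hr1 : ∑ j, r j = 1 := by
        simp only [hr]; rw [← Finset.sum_div, hqs a]; exact div_self hw0.ne'
      have hsum : ∑ j, negMulLog (q a j) = negMulLog w + ∑ j, w * negMulLog (r j) := by
        simp_rw [hqr, negMulLog_mul]
        rw [Finset.sum_add_distrib, ← Finset.sum_mul, hr1, one_mul]
      rw [hsum]
      refine add_le_add le_rfl (Finset.sum_le_sum fun j _ => ?_)
      have hi := (hp.integrable ν j).integrableOn (s := α ⁻¹' {a})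
      have hrange : ∀ x ∈ α ⁻¹' {a}, |r j - p j x| ≤ δ / 2 := by
        intro x hx
        have hx' : α x = a := hx
        have hub : q a j ≤ w * (p j x + δ / 2) := by
          have : ∫ y in α ⁻¹' {a}, p j y ∂ν ≤ ∫ y in α ⁻¹' {a}, (p j x + δ / 2) ∂ν := by
            refine setIntegral_mono_on hi (integrable_const _) (hmS a) fun y hy => ?_
            have := (abs_lt.1 (hosc y x (Eq.trans hy hx'.symm) j)).2
            linarith
          simpa [hq, hw] using this
        have hlb : w * (p j x - δ / 2) ≤ q a j := by
          have : ∫ y in α ⁻¹' {a}, (p j x - δ / 2) ∂ν ≤ ∫ y in α ⁻¹' {a}, p j y ∂ν := by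
            refine setIntegral_mono_on (integrable_const _) hi (hmS a) fun y hy => ?_
            have := (abs_lt.1 (hosc y x (Eq.trans hy hx'.symm) j)).1
            linarith
          simpa [hq, hw] using this
        rw [hqr] at hub hlb
        have h1 := le_of_mul_le_mul_left hub hw0
        have h2 := le_of_mul_le_mul_left hlb hw0
        rw [abs_le]; constructor <;> linarith
      have hr0 : ∀ j, 0 ≤ r j := fun j =>
        div_nonneg (integral_nonneg (hp.nonneg j)) hw0.le
      have hrle : r j ≤ 1 := by
        rw [← hr1]
        exact Finset.single_le_sum (f := r) (fun i _ => hr0 i) (Finset.mem_univ j)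
      have hpt : ∀ x ∈ α ⁻¹' {a}, negMulLog (r j) ≤ negMulLog (p j x) + η := by
        intro x hx
        have := hδ' (r j) ⟨hr0 j, hrle⟩ (p j x) ⟨hp.nonneg j x, hp.le_one j x⟩ (by
          rw [Real.dist_eq]; linarith [hrange x hx])
        rw [Real.dist_eq] at this
        linarith [(abs_lt.1 this).2]
      have hin := (hp.integrable_nml ν j).integrableOn (s := α ⁻¹' {a})
      have : ∫ y in α ⁻¹' {a}, negMulLog (r j) ∂ν
          ≤ ∫ y in α ⁻¹' {a}, (negMulLog (p j y) + η) ∂ν :=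
        setIntegral_mono_on (integrable_const _) (hin.add (integrable_const _)) (hmS a) hpt
      rw [integral_add hin (integrable_const _)] at this
      simp only [integral_const, MeasurableSet.univ, measureReal_restrict_apply, univ_inter,
        smul_eq_mul] at this
      rw [mul_comm η]
      exact this
  rw [shannonEntropy_eq, shannonEntropy_eq, shannonEntropy_eq, ← add_div, ← sub_div]
  refine div_le_div_of_nonneg_right ?_ hl2.le
  rw [Fintype.sum_prod_type]
  simp_rw [hpair, hXa, hNb]
  have h1 := Finset.sum_le_sum fun a (_ : a ∈ Finset.univ) => hcell a
  rw [Finset.sum_add_distrib, Finset.sum_comm (f := fun a j =>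
    ((∫ x in α ⁻¹' {a}, negMulLog (p j x) ∂ν) + η * ν.real (α ⁻¹' {a})))] at h1
  have hw1 : ∑ a, ν.real (α ⁻¹' {a}) = 1 := by
    have := hpart (fun _ => 1) (integrable_const _)
    simpa using this
  have h2 : ∀ j, ∑ a, ((∫ x in α ⁻¹' {a}, negMulLog (p j x) ∂ν) + η * ν.real (α ⁻¹' {a}))
      = (∫ x, negMulLog (p j x) ∂ν) + η := by
    intro j
    rw [Finset.sum_add_distrib, hpart _ (hp.integrable_nml ν j), ← Finset.mul_sum, hw1, mul_one]
  simp_rw [h2] at h1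
  rw [Finset.sum_add_distrib] at h1
  simp only [Finset.sum_const, Finset.card_univ, Fintype.card_fin, nsmul_eq_mul] at h1
  unfold chanInfo
  rw [Finset.sum_sub_distrib]
  linarith

lemma chanInfo_nonneg (hp : IsChan p) : 0 ≤ chanInfo ν p := by
  refine Finset.sum_nonneg fun j _ => sub_nonneg.2 ?_
  exact concaveOn_negMulLog.le_map_integral continuous_negMulLog.continuousOn isClosed_Ici
    (ae_of_all _ fun x => hp.nonneg j x) (hp.integrable ν j) (hp.integrable_nml ν j)

end

end InfoHelpers

section L1Helpers

instance boxMeasure_finite (d : ℕ) (L : ℝ) : IsFiniteMeasure (boxMeasure d L) := by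
  constructor
  rw [boxMeasure, Measure.restrict_apply_univ]
  refine Bornology.IsBounded.measure_lt_top ?_
  exact Bornology.IsBounded.pi fun _ => Metric.isBounded_Ico 0 L

variable {X : Type*} [MetricSpace X] [CompactSpace X] {d : ℕ} {L : ℝ}

lemma dist_le_D (x y : X) : dist x y ≤ Metric.diam (univ : Set X) :=
  Metric.dist_le_diam_of_mem isCompact_univ.isBounded (mem_univ x) (mem_univ y)

lemma integrable_dist_of {Z : Type*} [MeasurableSpace Z] {B : Measure Z} [IsFiniteMeasure B]
    {f g : Z → X} (hf : AEStronglyMeasurable f B)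
    (hg : AEStronglyMeasurable g B) : Integrable (fun u => dist (f u) (g u)) B :=
  Integrable.of_bound (hf.dist hg) (Metric.diam (univ : Set X))
    (ae_of_all _ fun u => by
      rw [Real.norm_of_nonneg dist_nonneg]; exact dist_le_D _ _)

lemma exists_dense_L1 [Nonempty X] {η : ℝ} (hη : 0 < η) :
    ∃ g : ℕ → L1Maps d L X, ∀ f, ∃ n, L1dist (g n) f < η := by
  classical
  set B := boxMeasure d L with hB
  set M := B.real univ with hM
  have hM0 : 0 ≤ M := measureReal_nonneg
  set δ := η / (4 * (M + 1)) with hδd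
  have hδ : 0 < δ := by positivity
  obtain ⟨t, -, htf, hcov⟩ := finite_cover_balls_of_compact (isCompact_univ (X := X)) hδ
  have : Fintype t := htf.fintype
  let Φ : X → (t → ℝ) := fun x i => dist x i.1
  have hΦ : Continuous Φ := by fun_prop
  have hΦd : ∀ x y, dist x y ≤ ‖Φ x - Φ y‖ + 2 * δ := by
    intro x y
    obtain ⟨i, hi, hxi⟩ := mem_iUnion₂.1 (hcov (mem_univ x))
    have h1 : dist x i < δ := hxi
    have h2 := norm_le_pi_norm (Φ x - Φ y) ⟨i, hi⟩
    simp only [Pi.sub_apply, Φ, Real.norm_eq_abs] at h2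
    have h3 := neg_abs_le (dist x i - dist y i)
    have h4 := dist_triangle_right x y i
    linarith
  have hint : ∀ f : L1Maps d L X, Integrable (fun u => Φ (f u)) B := by
    intro f
    refine Integrable.of_bound (hΦ.comp_aestronglyMeasurable f.aestronglyMeasurable)
      (Metric.diam (univ : Set X)) (ae_of_all _ fun u => ?_)
    rw [pi_norm_le_iff_of_nonneg Metric.diam_nonneg]
    intro i
    rw [Real.norm_of_nonneg dist_nonneg]; exact dist_le_D _ _
  let F : L1Maps d L X → Lp (t → ℝ) 1 B := fun f => (hint f).toL1 _
  have : Nonempty (L1Maps d L X) :=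
    ⟨AEEqFun.const _ (Classical.arbitrary X)⟩
  have : Fact ((1 : ℝ≥0∞) ≠ ∞) := ⟨ENNReal.one_ne_top⟩
  have : SecondCountableTopology (Lp (t → ℝ) 1 B) := Lp.SecondCountableTopology
  have : Nonempty (range F) := ⟨⟨F (Classical.arbitrary _), mem_range_self _⟩⟩
  let s := TopologicalSpace.denseSeq (range F)
  have hs : ∀ n, ∃ g, F g = s n := fun n => (s n).2
  choose g hg using hs
  refine ⟨g, fun f => ?_⟩
  obtain ⟨n, hn⟩ := (TopologicalSpace.denseRange_denseSeq (range F)).exists_dist_lt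
    ⟨F f, mem_range_self f⟩ (half_pos hη)
  refine ⟨n, ?_⟩
  have h1 : dist (F f) (F (g n)) < η / 2 := by
    rw [hg n]; exact hn
  have h2 : dist (F f) (F (g n)) = ∫ u, ‖Φ (f u) - Φ (g n u)‖ ∂B := by
    rw [dist_eq_norm, L1.norm_eq_integral_norm]
    refine integral_congr_ae ?_
    filter_upwards [Lp.coeFn_sub (F f) (F (g n)), (hint f).coeFn_toL1, (hint (g n)).coeFn_toL1]
      with u h3 h4 h5
    rw [h3, Pi.sub_apply]
    simp only [F]
    rw [h4, h5]
  have h3 : L1dist (g n) f ≤ ∫ u, (‖Φ (f u) - Φ (g n u)‖ + 2 * δ) ∂B := by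
    refine integral_mono (integrable_dist_of (g n).aestronglyMeasurable f.aestronglyMeasurable)
      (((hint f).sub (hint (g n))).norm.add (integrable_const _)) fun u => ?_
    simp only
    rw [dist_comm]; exact hΦd _ _
  rw [integral_add (f := fun u => ‖Φ (f u) - Φ (g n u)‖) ((hint f).sub (hint (g n))).norm
    (integrable_const _), ← h2] at h3
  simp only [integral_const, smul_eq_mul] at h3
  have h4 : B.real univ * (2 * δ) ≤ η / 2 := by
    rw [← hM, hδd]
    have : M * (2 * (η / (4 * (M + 1)))) = η / 2 * (M / (M + 1)) := by field_simp; ring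
    rw [this]
    have : M / (M + 1) ≤ 1 := by rw [div_le_one (by positivity)]; linarith
    nlinarith
  linarith

/-- The total cost. -/
noncomputable def cost (d : ℕ) (T : (Fin d → ℝ) → X → X) (L : ℝ) (x : X) (y : L1Maps d L X) : ℝ :=
  ∫ u, dist (T u x) (y u) ∂(boxMeasure d L)

variable {T : (Fin d → ℝ) → X → X}

lemma orbit_aesm (hT : IsContAction d T) (x : X) :
    AEStronglyMeasurable (fun u => T u x) (boxMeasure d L) :=
  (hT.1.comp (by fun_prop : Continuous fun u : Fin d → ℝ => (u, x))).aestronglyMeasurable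

lemma measurable_L1dist (f : L1Maps d L X) : Measurable (fun g : L1Maps d L X => L1dist f g) := by
  refine measurable_of_Iio fun r => ?_
  exact MeasurableSpace.measurableSet_generateFrom ⟨f, r, rfl⟩

lemma cost_eq (hT : IsContAction d T) (x : X) (y : L1Maps d L X) :
    cost d T L x y = L1dist (AEEqFun.mk _ (orbit_aesm hT x)) y := by
  refine integral_congr_ae ?_
  filter_upwards [AEEqFun.coeFn_mk _ (orbit_aesm (L := L) hT x)] with u hu
  rw [hu]

lemma cost_nonneg (x : X) (y : L1Maps d L X) : 0 ≤ cost d T L x y :=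
  integral_nonneg fun _ => dist_nonneg

lemma cost_le (hT : IsContAction d T) (x : X) (y : L1Maps d L X) :
    cost d T L x y ≤ Metric.diam (univ : Set X) * (boxMeasure d L).real univ := by
  have := integral_mono (μ := boxMeasure d L)
    (integrable_dist_of (orbit_aesm hT x) y.aestronglyMeasurable)
    (integrable_const (Metric.diam (univ : Set X))) (fun u => dist_le_D (T u x) (y u))
  simp only [integral_const, smul_eq_mul] at this
  rw [mul_comm]; exact this

lemma measurable_cost [MeasurableSpace X] [BorelSpace X] (hT : IsContAction d T) :
    Measurable (Function.uncurry (cost d T L)) := by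
  refine measurable_uncurry_of_continuous_of_measurable (fun y => ?_) (fun x => ?_)
  · refine continuous_of_dominated (bound := fun _ => Metric.diam (univ : Set X))
      (fun x => ?_) (fun x => ?_) (integrable_const _) ?_
    · exact (orbit_aesm hT x).dist y.aestronglyMeasurable
    · refine ae_of_all _ fun u => ?_
      rw [Real.norm_of_nonneg dist_nonneg]; exact dist_le_D _ _
    · refine ae_of_all _ fun u => ?_
      exact (hT.1.comp (by fun_prop : Continuous fun x : X => (u, x))).dist continuous_const
  · have : cost d T L x = fun y => L1dist (AEEqFun.mk _ (orbit_aesm hT x)) y :=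
      funext fun y => cost_eq hT x y
    rw [this]
    exact measurable_L1dist _

lemma cost_triangle (hT : IsContAction d T) (x : X) (y z : L1Maps d L X) :
    cost d T L x z ≤ cost d T L x y + L1dist z y := by
  unfold cost L1dist
  rw [← integral_add (integrable_dist_of (orbit_aesm hT x) y.aestronglyMeasurable)
    (integrable_dist_of z.aestronglyMeasurable y.aestronglyMeasurable)]
  refine integral_mono (integrable_dist_of (orbit_aesm hT x) z.aestronglyMeasurable)
    ((integrable_dist_of (orbit_aesm hT x) y.aestronglyMeasurable).add
    (integrable_dist_of z.aestronglyMeasurable y.aestronglyMeasurable)) fun u => ?_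
  exact dist_triangle_right _ _ _

lemma distortion_eq {Ω : Type*} [MeasurableSpace Ω] (P : Measure Ω) (Xv : Ω → X)
    (Yv : Ω → L1Maps d L X) :
    distortion d T L P Xv Yv = (L ^ d)⁻¹ * ∫ ω, cost d T L (Xv ω) (Yv ω) ∂P := by
  unfold distortion
  rw [integral_const_mul]; rfl

lemma exists_quantization [Nonempty X] [MeasurableSpace X] [BorelSpace X] (hT : IsContAction d T)
    (hL : 0 < L) {Ω : Type*} [MeasurableSpace Ω] (P : Measure Ω) [IsProbabilityMeasure P]
    (Xv : Ω → X) (Yv : Ω → L1Maps d L X) (hX : Measurable Xv) (hY : Measurable Yv) {ε : ℝ}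
    (hD : distortion d T L P Xv Yv < ε) :
    ∃ (m : ℕ) (y : Fin (m + 1) → L1Maps d L X) (q : L1Maps d L X → Fin (m + 1)), Measurable q ∧
      (L ^ d)⁻¹ * ∫ ω, cost d T L (Xv ω) (y (q (Yv ω))) ∂P < ε := by
  classical
  have hLd : 0 < L ^ d := by positivity
  rw [distortion_eq] at hD
  have hD' : ∫ ω, cost d T L (Xv ω) (Yv ω) ∂P < L ^ d * ε := by
    rwa [inv_mul_lt_iff₀ hLd] at hD
  set C := Metric.diam (univ : Set X) * (boxMeasure d L).real univ with hC
  obtain ⟨η, hη, hηlt⟩ : ∃ η > 0, ∫ ω, cost d T L (Xv ω) (Yv ω) ∂P + η < L ^ d * ε :=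
    ⟨(L ^ d * ε - ∫ ω, cost d T L (Xv ω) (Yv ω) ∂P) / 2, by linarith, by linarith⟩
  obtain ⟨g, hg⟩ := exists_dense_L1 (X := X) (d := d) (L := L) hη
  let n : L1Maps d L X → ℕ := fun f => Nat.find (hg f)
  have hn : Measurable n := measurable_find hg fun k =>
    measurable_L1dist (g k) measurableSet_Iio
  have hns : ∀ f, L1dist (g (n f)) f < η := fun f => Nat.find_spec (hg f)
  have hnY : Measurable fun ω => n (Yv ω) := hn.comp hY
  have hgm : ∀ N : Ω → ℕ, Measurable N → Measurable fun ω => cost d T L (Xv ω) (g (N ω)) := by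
    intro N hN
    exact (measurable_cost hT).comp (hX.prodMk ((measurable_of_countable g).comp hN))
  have hbd : ∀ x (y : L1Maps d L X), ‖cost d T L x y‖ ≤ C := fun x y => by
    rw [Real.norm_of_nonneg (cost_nonneg x y)]; exact cost_le hT x y
  have hi1 : Integrable (fun ω => cost d T L (Xv ω) (Yv ω)) P :=
    Integrable.of_bound ((measurable_cost hT).comp (hX.prodMk hY)).aestronglyMeasurable C
      (ae_of_all _ fun ω => hbd _ _)
  have hi2 : Integrable (fun ω => cost d T L (Xv ω) (g (n (Yv ω)))) P :=
    Integrable.of_bound (hgm _ hnY).aestronglyMeasurable C (ae_of_all _ fun ω => hbd _ _)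
  have h1 : ∫ ω, cost d T L (Xv ω) (g (n (Yv ω))) ∂P < L ^ d * ε := by
    have : ∫ ω, cost d T L (Xv ω) (g (n (Yv ω))) ∂P ≤ ∫ ω, (cost d T L (Xv ω) (Yv ω) + η) ∂P := by
      refine integral_mono hi2 (hi1.add (integrable_const _)) fun ω => ?_
      have := cost_triangle hT (Xv ω) (Yv ω) (g (n (Yv ω)))
      have := hns (Yv ω)
      simp only; linarith
    rw [integral_add hi1 (integrable_const _)] at this
    simp at this
    linarith
  let q : (m : ℕ) → L1Maps d L X → Fin (m + 1) := fun m f =>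
    if h : n f < m + 1 then ⟨n f, h⟩ else 0
  have hq : ∀ m, Measurable (q m) := by
    intro m
    exact (measurable_of_countable (fun k : ℕ => if h : k < m + 1 then (⟨k, h⟩ : Fin (m + 1)) else 0)).comp hn
  have hlim : Tendsto (fun m => ∫ ω, cost d T L (Xv ω) (g (q m (Yv ω))) ∂P) atTop
      (𝓝 (∫ ω, cost d T L (Xv ω) (g (n (Yv ω))) ∂P)) := by
    refine tendsto_integral_of_dominated_convergence (fun _ => C) (fun m => ?_)
      (integrable_const _) (fun m => ae_of_all _ fun ω => hbd _ _) (ae_of_all _ fun ω => ?_)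
    · exact (hgm (fun ω => (q m (Yv ω) : ℕ))
        ((measurable_of_countable _).comp ((hq m).comp hY))).aestronglyMeasurable
    · refine tendsto_const_nhds.congr' ?_
      filter_upwards [eventually_ge_atTop (n (Yv ω))] with m hm
      simp only [q]
      rw [dif_pos (Nat.lt_succ_of_le hm)]
  obtain ⟨m, hm⟩ := (hlim.eventually (gt_mem_nhds h1)).exists
  refine ⟨m, fun j => g j, q m, hq m, ?_⟩
  rwa [inv_mul_lt_iff₀ hLd]

end L1Helpers

section MainHelpers
open ProbabilityTheory

lemma isChan_kernel {A : Type*} [MeasurableSpace A] {m : ℕ} (K : Kernel A (Fin m))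
    [IsMarkovKernel K] : IsChan (fun j x => (K x).real {j}) where
  meas j := (Kernel.measurable_coe K (measurableSet_singleton j)).ennreal_toReal
  nonneg _ _ := measureReal_nonneg
  sum_one x := by
    rw [sum_measureReal_singleton]
    simp

lemma jointLaw_of_map {A Ω : Type*} [MeasurableSpace A] [MeasurableSpace Ω] {m : ℕ}
    (K : Kernel A (Fin m)) [IsMarkovKernel K] (P : Measure Ω)
    (ν : Measure A) [IsProbabilityMeasure ν] {Xv : Ω → A} {N : Ω → Fin m}
    (hX : Measurable Xv) (hN : Measurable N) (h : P.map (fun ω => (Xv ω, N ω)) = ν ⊗ₘ K) :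
    JointLaw P Xv N ν (fun j x => (K x).real {j}) where
  mN := hN
  mX := hX
  joint S hS j := by
    have hm := Kernel.measurable_coe K (measurableSet_singleton j)
    have e : Xv ⁻¹' S ∩ N ⁻¹' {j} = (fun ω => (Xv ω, N ω)) ⁻¹' (S ×ˢ {j}) := by
      ext ω; simp
    rw [Measure.real, e, ← Measure.map_apply (hX.prodMk hN) (hS.prod (measurableSet_singleton j)),
      h, Measure.compProd_apply_prod hS (measurableSet_singleton j)]
    simp only [Measure.real]
    rw [integral_toReal hm.aemeasurable (ae_of_all _ fun x => measure_lt_top _ _)]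

lemma RL_le_chanInfo {X : Type*} [MetricSpace X] [CompactSpace X] [MeasurableSpace X]
    [BorelSpace X] [Nonempty X] {d : ℕ} {T : (Fin d → ℝ) → X → X} (hT : IsContAction d T) {L : ℝ}
    (ν : Measure X) [IsProbabilityMeasure ν] {m : ℕ} (K : Kernel X (Fin m))
    [IsMarkovKernel K] (y : Fin m → L1Maps d L X) {ε : ℝ}
    (hε : (L ^ d)⁻¹ * ∫ x, ∫ j, cost d T L x (y j) ∂(K x) ∂ν < ε) :
    RL d T ν L ε ≤ ENNReal.ofReal (chanInfo ν (fun j x => (K x).real {j}) / Real.log 2) := by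
  have he := measurableEmbedding_embeddingReal X
  set e := embeddingReal X with hedef
  have hsec : MeasurableEmbedding e := he
  let P : Measure (ℝ × Fin m) := (ν ⊗ₘ K).map (fun z => (e z.1, z.2))
  have hme : Measurable (fun z : X × Fin m => (e z.1, z.2)) :=
    (he.measurable.comp measurable_fst).prodMk measurable_snd
  have : IsProbabilityMeasure P := Measure.isProbabilityMeasure_map hme.aemeasurable
  let Xv : ℝ × Fin m → X := fun ω => he.invFun ω.1
  let N : ℝ × Fin m → Fin m := Prod.snd
  have hX : Measurable Xv := he.measurable_invFun.comp measurable_fst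
  have hN : Measurable N := measurable_snd
  have hjoint : P.map (fun ω => (Xv ω, N ω)) = ν ⊗ₘ K := by
    rw [Measure.map_map (hX.prodMk hN) hme]
    have : (fun ω => (Xv ω, N ω)) ∘ (fun z : X × Fin m => (e z.1, z.2)) = id := by
      funext z
      simp only [Function.comp, Xv, N, id]
      rw [he.leftInverse_invFun z.1]
    rw [this, Measure.map_id]
  have hJ := jointLaw_of_map K P ν hX hN hjoint
  have hlaw : P.map Xv = ν := by
    have : P.map Xv = (P.map (fun ω => (Xv ω, N ω))).map Prod.fst := by
      rw [Measure.map_map measurable_fst (hX.prodMk hN)]; rfl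
    rw [this, hjoint]
    exact Measure.fst_compProd ν K
  have hY : Measurable fun ω => y (N ω) := (measurable_of_countable y).comp hN
  have hcm : Measurable fun z : X × Fin m => cost d T L z.1 (y z.2) :=
    (measurable_cost hT).comp (measurable_fst.prodMk ((measurable_of_countable y).comp measurable_snd))
  have hdist : distortion d T L P Xv (fun ω => y (N ω)) < ε := by
    rw [distortion_eq]
    refine lt_of_eq_of_lt ?_ hε
    congr 1
    have h1 : ∫ ω, cost d T L (Xv ω) (y (N ω)) ∂P
        = ∫ z, cost d T L z.1 (y z.2) ∂(P.map (fun ω => (Xv ω, N ω))) := by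
      rw [integral_map (hX.prodMk hN).aemeasurable hcm.aestronglyMeasurable]
    rw [h1, hjoint, Measure.integral_compProd]
    refine Integrable.of_bound hcm.aestronglyMeasurable
      (Metric.diam (univ : Set X) * (boxMeasure d L).real univ) (ae_of_all _ fun z => ?_)
    rw [Real.norm_of_nonneg (cost_nonneg _ _)]; exact cost_le hT _ _
  unfold RL
  refine iInf_le_of_le (ℝ × Fin m) <| iInf_le_of_le inferInstance <| iInf_le_of_le P <|
    iInf_le_of_le this <| iInf_le_of_le Xv <| iInf_le_of_le (fun ω => y (N ω)) <|
    iInf_le_of_le hX <| iInf_le_of_le hY <| iInf_le_of_le hlaw <| iInf_le_of_le hdist ?_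
  unfold mutualInfo
  refine iSup_le fun n => iSup_le fun k => iSup_le fun α => iSup_le fun hα => iSup_le fun β =>
    iSup_le fun _ => ENNReal.ofReal_le_ofReal ?_
  exact hJ.info_le (isChan_kernel K) α hα (fun j => β (y j))

section bind
variable {Z X : Type*} [MeasurableSpace Z] [MeasurableSpace X] (lam : Measure Z)
    [IsProbabilityMeasure lam] (V : Z → Measure X) (hV : Measurable V)
    [∀ z, IsProbabilityMeasure (V z)] {g : X → ℝ} (hg : Measurable g) (hg0 : ∀ x, 0 ≤ g x)
    {C : ℝ} (hC : ∀ x, g x ≤ C)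

lemma integrable_bdd (hg : Measurable g) (hg0 : ∀ x, 0 ≤ g x) (hC : ∀ x, g x ≤ C)
    (ν : Measure X) [IsProbabilityMeasure ν] : Integrable g ν :=
  Integrable.of_bound hg.aestronglyMeasurable C (ae_of_all _ fun x => by
      rw [Real.norm_of_nonneg (hg0 x)]; exact hC x)

lemma measurable_integral_bdd (hV : Measurable V) (hg : Measurable g) (hg0 : ∀ x, 0 ≤ g x) :
    Measurable fun z => ∫ x, g x ∂(V z) := by
  have : (fun z => ∫ x, g x ∂(V z)) = fun z => (∫⁻ x, ENNReal.ofReal (g x) ∂(V z)).toReal := by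
    funext z
    exact integral_eq_lintegral_of_nonneg_ae (ae_of_all _ hg0) hg.aestronglyMeasurable
  rw [this]
  exact ((Measure.measurable_lintegral hg.ennreal_ofReal).comp hV).ennreal_toReal

lemma integral_bdd_le (hg : Measurable g) (hg0 : ∀ x, 0 ≤ g x) (hC : ∀ x, g x ≤ C)
    (ν : Measure X) [IsProbabilityMeasure ν] : ∫ x, g x ∂ν ≤ C := by
  have := integral_mono (integrable_bdd hg hg0 hC ν) (integrable_const C) hC
  simpa using this

lemma integral_bary (hV : Measurable V) (hg : Measurable g) (hg0 : ∀ x, 0 ≤ g x)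
    (hC : ∀ x, g x ≤ C) :
    ∫ x, g x ∂(lam.bind V) = ∫ z, ∫ x, g x ∂(V z) ∂lam := by
  rw [integral_eq_lintegral_of_nonneg_ae (ae_of_all _ hg0) hg.aestronglyMeasurable,
    integral_eq_lintegral_of_nonneg_ae (ae_of_all _ fun z => integral_nonneg hg0)
      (measurable_integral_bdd V hV hg hg0).aestronglyMeasurable,
    Measure.lintegral_bind hV.aemeasurable hg.ennreal_ofReal.aemeasurable]
  congr 1
  refine lintegral_congr fun z => ?_
  rw [ofReal_integral_eq_lintegral_ofReal (integrable_bdd hg hg0 hC (V z)) (ae_of_all _ hg0)]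

/-- Concavity of the mutual information in the input law. -/
lemma chanInfo_bary {m : ℕ} {p : Fin m → X → ℝ} (hp : IsChan p) (hV : Measurable V) :
    Integrable (fun z => chanInfo (V z) p) lam ∧
      ∫ z, chanInfo (V z) p ∂lam ≤ chanInfo (lam.bind V) p := by
  have hnm : ∀ j, Measurable fun x => Real.negMulLog (p j x) := fun j =>
    Real.continuous_negMulLog.measurable.comp (hp.meas j)
  have m1 : ∀ j, Measurable fun z => ∫ x, p j x ∂(V z) := fun j =>
    measurable_integral_bdd V hV (hp.meas j) (hp.nonneg j)
  have m2 : ∀ j, Measurable fun z => ∫ x, Real.negMulLog (p j x) ∂(V z) := fun j =>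
    measurable_integral_bdd V hV (hnm j) (hp.nml_nonneg j)
  have b0 : ∀ j z, 0 ≤ ∫ x, p j x ∂(V z) := fun j z => integral_nonneg (hp.nonneg j)
  have b1 : ∀ j z, ∫ x, p j x ∂(V z) ≤ 1 := fun j z =>
    integral_bdd_le (hp.meas j) (hp.nonneg j) (hp.le_one j) _
  have i0 : ∀ j, Integrable (fun z => ∫ x, p j x ∂(V z)) lam := fun j =>
    integrable_bdd (m1 j) (b0 j) (b1 j) lam
  have i1 : ∀ j, Integrable (fun z => Real.negMulLog (∫ x, p j x ∂(V z))) lam := fun j =>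
    integrable_bdd (C := 1) (Real.continuous_negMulLog.measurable.comp (m1 j))
      (fun z => Real.negMulLog_nonneg (b0 j z) (b1 j z))
      (fun z => (Real.negMulLog_le_one_sub_self (b0 j z)).trans (by linarith [b0 j z])) lam
  have i2 : ∀ j, Integrable (fun z => ∫ x, Real.negMulLog (p j x) ∂(V z)) lam := fun j =>
    integrable_bdd (m2 j) (fun z => integral_nonneg (hp.nml_nonneg j))
      (fun z => integral_bdd_le (hnm j) (hp.nml_nonneg j) (hp.nml_le j) _) lam
  refine ⟨?_, ?_⟩
  · unfold chanInfo
    exact integrable_finsetSum _ fun j _ => (i1 j).sub (i2 j)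
  · unfold chanInfo
    rw [integral_finsetSum (f := fun j z => Real.negMulLog (∫ x, p j x ∂(V z))
      - ∫ x, Real.negMulLog (p j x) ∂(V z)) _ fun j _ => (i1 j).sub (i2 j)]
    refine Finset.sum_le_sum fun j _ => ?_
    rw [integral_sub (i1 j) (i2 j), integral_bary lam V hV (hp.meas j) (hp.nonneg j) (hp.le_one j),
      integral_bary lam V hV (hnm j) (hp.nml_nonneg j) (hp.nml_le j)]
    refine sub_le_sub_right ?_ _
    exact Real.concaveOn_negMulLog.le_map_integral Real.continuous_negMulLog.continuousOn
      isClosed_Ici (ae_of_all _ fun z => b0 j z) (i0 j) (i1 j)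

end bind

lemma JointLaw.chanInfo_le_mutualInfo {A B Ω : Type*} [MeasurableSpace A] [MeasurableSpace B]
    [MeasurableSpace Ω] {P : Measure Ω} [IsProbabilityMeasure P] {m : ℕ} {Xv : Ω → A} {Yv : Ω → B}
    {q : B → Fin (m + 1)} (hq : Measurable q) {ν : Measure A} [IsProbabilityMeasure ν]
    {p : Fin (m + 1) → A → ℝ} (hp : IsChan p)
    (hJ : JointLaw P Xv (fun ω => q (Yv ω)) ν p) :
    ENNReal.ofReal (chanInfo ν p / Real.log 2) ≤ mutualInfo P Xv Yv := by
  have hl2 : 0 < Real.log 2 := Real.log_pos (by norm_num)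
  by_cases htop : mutualInfo P Xv Yv = ⊤
  · rw [htop]; exact le_top
  rw [ENNReal.ofReal_le_iff_le_toReal htop]
  refine le_of_forall_pos_le_add fun e he => ?_
  obtain ⟨n, α, hα, hle⟩ := hJ.le_info hp (η := e * Real.log 2 / (m + 1)) (by positivity)
  have h1 : (chanInfo ν p - ((m + 1 : ℕ) : ℝ) * (e * Real.log 2 / (m + 1))) / Real.log 2
      = chanInfo ν p / Real.log 2 - e := by
    push_cast; field_simp
  rw [h1] at hle
  have h2 : ENNReal.ofReal (chanInfo ν p / Real.log 2 - e) ≤ mutualInfo P Xv Yv := by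
    refine (ENNReal.ofReal_le_ofReal hle).trans ?_
    unfold mutualInfo
    exact le_iSup_of_le n <| le_iSup_of_le (m + 1) <| le_iSup_of_le α <| le_iSup_of_le hα <|
      le_iSup_of_le q <| le_iSup_of_le hq le_rfl
  rw [ENNReal.ofReal_le_iff_le_toReal htop] at h2
  linarith

end MainHelpers

/-- Lemma 3.6: lower bound of the rate distortion function of a barycenter by the infimum of
the integrated fiberwise rate distortion functions. -/
theorem RD_barycenter_ge_inf
    {X : Type*} [MetricSpace X] [CompactSpace X] [MeasurableSpace X] [BorelSpace X]
    (d : ℕ) (hd : 0 < d) (T : (Fin d → ℝ) → X → X) (hT : IsContAction d T)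
    (lam : Measure (InvM X d T)) [IsProbabilityMeasure lam]
    (μ : Measure X) [IsProbabilityMeasure μ] (hμinv : MeasInvariant d T μ)
    (hbar : ∀ A : Set X, MeasurableSet A → μ A = ∫⁻ ν, (ν.1 : Measure X) A ∂lam)
    (ε : ℝ) (hε : 0 < ε) :
    sInf {r : ℝ≥0∞ | ∃ f : InvM X d T → ℝ, Measurable f ∧ (∀ ν, 0 < f ν) ∧
        (∫⁻ ν, ENNReal.ofReal (f ν) ∂lam) ≤ ENNReal.ofReal ε ∧
        r = ∫⁻ ν, RD d T (ν.1 : Measure X) (f ν) ∂lam}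
      ≤ RD d T μ ε := by
  classical
  have hne : Nonempty X := by
    by_contra h
    rw [not_nonempty_iff] at h
    have h1 : μ univ = 1 := measure_univ
    rw [univ_eq_empty_iff.2 h, measure_empty] at h1
    exact zero_ne_one h1
  let V : InvM X d T → Measure X := fun ν => (ν.1 : Measure X)
  have hV : Measurable V := measurable_subtype_coe.comp measurable_subtype_coe
  have hVp : ∀ ν, IsProbabilityMeasure (V ν) := fun ν => inferInstance
  have hμ : μ = lam.bind V := by
    ext A hA
    rw [hbar A hA, Measure.bind_apply hA hV.aemeasurable]
  have hl2 : 0 < Real.log 2 := Real.log_pos (by norm_num)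
  rw [RD]
  refine le_iInf₂ fun L hL => ?_
  have hLd : 0 < L ^ d := by positivity
  have hc0 : ENNReal.ofReal (L ^ d) ≠ 0 := by simpa using hLd
  have hct : ENNReal.ofReal (L ^ d) ≠ ⊤ := ENNReal.ofReal_ne_top
  rw [ENNReal.le_div_iff_mul_le (Or.inl hc0) (Or.inl hct)]
  rw [RL]
  refine le_iInf fun Ω => le_iInf fun mΩ => le_iInf fun P => le_iInf fun hP => le_iInf fun Xv =>
    le_iInf fun Yv => le_iInf fun hX => le_iInf fun hY => le_iInf fun hlaw => le_iInf fun hD => ?_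
  obtain ⟨m, y, q, hq, hDq⟩ := exists_quantization hT hL P Xv Yv hX hY hD
  let N : Ω → Fin (m + 1) := fun ω => q (Yv ω)
  have hN : Measurable N := hq.comp hY
  let K : ProbabilityTheory.Kernel X (Fin (m + 1)) := ProbabilityTheory.condDistrib N Xv P
  have hK : ProbabilityTheory.IsMarkovKernel K := inferInstance
  have hjoint : P.map (fun ω => (Xv ω, N ω)) = μ.compProd K := by
    rw [← hlaw]
    exact (ProbabilityTheory.compProd_map_condDistrib hN.aemeasurable).symm
  have hJ := jointLaw_of_map K P μ hX hN hjoint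
  have hp := isChan_kernel K
  set p : Fin (m + 1) → X → ℝ := fun j x => (K x).real {j} with hpdef
  -- the averaged cost
  set C := Metric.diam (univ : Set X) * (boxMeasure d L).real univ with hC
  have hcm : Measurable fun z : X × Fin (m + 1) => cost d T L z.1 (y z.2) :=
    (measurable_cost hT).comp
      (measurable_fst.prodMk ((measurable_of_countable y).comp measurable_snd))
  let g : X → ℝ := fun x => ∫ j, cost d T L x (y j) ∂(K x)
  have hg : Measurable g :=
    (hcm.stronglyMeasurable.integral_kernel_prod_right' (κ := K)).measurable
  have hg0 : ∀ x, 0 ≤ g x := fun x => integral_nonneg fun j => cost_nonneg _ _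
  have hgC : ∀ x, g x ≤ C := fun x =>
    integral_bdd_le (measurable_of_countable _) (fun j => cost_nonneg _ _)
      (fun j => cost_le hT _ _) (K x)
  have hgμ : ∫ x, g x ∂μ = ∫ ω, cost d T L (Xv ω) (y (N ω)) ∂P := by
    have h1 : ∫ ω, cost d T L (Xv ω) (y (N ω)) ∂P
        = ∫ z, cost d T L z.1 (y z.2) ∂(P.map (fun ω => (Xv ω, N ω))) := by
      rw [integral_map (hX.prodMk hN).aemeasurable hcm.aestronglyMeasurable]
    rw [h1, hjoint, Measure.integral_compProd]
    exact integrable_bdd hcm (fun z => cost_nonneg _ _) (fun z => cost_le hT _ _) _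
  have hDg : (L ^ d)⁻¹ * ∫ x, g x ∂μ < ε := by rw [hgμ]; exact hDq
  set δ := ε - (L ^ d)⁻¹ * ∫ x, g x ∂μ with hδ
  have hδ0 : 0 < δ := by rw [hδ]; linarith
  have hgV : Measurable fun ν => ∫ x, g x ∂(V ν) := measurable_integral_bdd V hV hg hg0
  let f : InvM X d T → ℝ := fun ν => (L ^ d)⁻¹ * ∫ x, g x ∂(V ν) + δ
  have hf : Measurable f := (hgV.const_mul _).add_const _
  have hfpos : ∀ ν, 0 < f ν := fun ν => by
    have : 0 ≤ ∫ x, g x ∂(V ν) := integral_nonneg hg0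
    simp only [f]; positivity
  have hgVi : Integrable (fun ν => ∫ x, g x ∂(V ν)) lam :=
    integrable_bdd hgV (fun ν => integral_nonneg hg0) (fun ν => integral_bdd_le hg hg0 hgC _) lam
  have hfi : ∫⁻ ν, ENNReal.ofReal (f ν) ∂lam ≤ ENNReal.ofReal ε := by
    have hfint : Integrable f lam := (hgVi.const_mul _).add (integrable_const _)
    rw [← ofReal_integral_eq_lintegral_ofReal hfint (ae_of_all _ fun ν => (hfpos ν).le)]
    refine ENNReal.ofReal_le_ofReal ?_
    simp only [f]
    rw [integral_add (hgVi.const_mul _) (integrable_const _), integral_const_mul,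
      ← integral_bary lam V hV hg hg0 hgC, ← hμ]
    simp [hδ]
  have hRD : ∀ ν : InvM X d T, RD d T (ν.1 : Measure X) (f ν)
      ≤ ENNReal.ofReal (chanInfo (V ν) p / Real.log 2) * (ENNReal.ofReal (L ^ d))⁻¹ := by
    intro ν
    rw [RD, ← div_eq_mul_inv]
    refine iInf₂_le_of_le L hL (ENNReal.div_le_div_right ?_ _)
    refine RL_le_chanInfo hT (V ν) K y ?_
    simp only [f]
    exact lt_add_of_pos_right _ hδ0
  obtain ⟨hJi, hJle⟩ := chanInfo_bary lam V hp hV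
  calc _ ≤ (∫⁻ ν, RD d T (ν.1 : Measure X) (f ν) ∂lam) * ENNReal.ofReal (L ^ d) := by
        gcongr
        exact sInf_le ⟨f, hf, hfpos, hfi, rfl⟩
    _ ≤ (∫⁻ ν, ENNReal.ofReal (chanInfo (V ν) p / Real.log 2) * (ENNReal.ofReal (L ^ d))⁻¹ ∂lam)
          * ENNReal.ofReal (L ^ d) := by
        gcongr with ν
        exact hRD ν
    _ = ∫⁻ ν, ENNReal.ofReal (chanInfo (V ν) p / Real.log 2) ∂lam := by
        rw [lintegral_mul_const' _ _ (ENNReal.inv_ne_top.2 hc0), mul_assoc,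
          ENNReal.inv_mul_cancel hc0 hct, mul_one]
    _ = ENNReal.ofReal (∫ ν, chanInfo (V ν) p / Real.log 2 ∂lam) := by
        rw [ofReal_integral_eq_lintegral_ofReal (hJi.div_const _)
          (ae_of_all _ fun ν => div_nonneg (chanInfo_nonneg hp) hl2.le)]
    _ ≤ ENNReal.ofReal (chanInfo μ p / Real.log 2) := by
        refine ENNReal.ofReal_le_ofReal ?_
        rw [integral_div, hμ]
        exact div_le_div_of_nonneg_right hJle hl2.le
    _ ≤ mutualInfo P Xv Yv := JointLaw.chanInfo_le_mutualInfo hq hp hJ
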